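/- Let M be a κ-combinatorial model category, let R_fib: M^→ → M^→ denote the replacement-by-fibration functor arising from the (trivial cofibration, fibration)-factorization given by the small object argument, and let R_wfib: M^→ → M^→ denote the replacement-by-trivial-fibration functor arising from the (cofibration, trivial fibration)-factorization. Let λ > κ be a regular cardinal such that both R_fib and R_wfib preserve λ-presentable objects. Then the full subcategory W of weak equivalences in M^→ is λ-accessible and is closed under κ-filtered colimits in M^→. -/

import Mathlib

open CategoryTheory CategoryTheory.Limits

universe w v u

namespace PaperAcc

/-- A category `J` is `κ`-filtered if every diagram indexed by a category with fewer than `κ`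
arrows admits a cocone. -/
def IsCardinalFiltered (J : Type v) [Category.{v} J] (κ : Cardinal.{v}) : Prop :=
  ∀ (A : Type v) [SmallCategory A], Cardinal.mk (Arrow A) < κ →
    ∀ F : A ⥤ J, Nonempty (Cocone F)

/-- A preorder `P` is `κ`-directed if every subset of cardinality `< κ` has an upper bound. -/
def IsCardinalDirected (P : Type v) [Preorder P] (κ : Cardinal.{v}) : Prop :=
  ∀ S : Set P, Cardinal.mk S < κ → ∃ p : P, ∀ s ∈ S, s ≤ p

/-- An object `X` is `κ`-presentable if `Hom(X, -)` preserves `κ`-filtered colimits. -/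
def IsPresentable {M : Type u} [Category.{v} M] (κ : Cardinal.{v}) (X : M) : Prop :=
  ∀ (J : Type v) [SmallCategory J], IsCardinalFiltered J κ →
    Nonempty (PreservesColimitsOfShape J (coyoneda.obj (Opposite.op X)))

/-- A presentation of `X` as a `κ`-filtered colimit of objects belonging to `P`. -/
structure FilteredColimitPresentation {M : Type u} [Category.{v} M] (κ : Cardinal.{v})
    (P : Set M) (X : M) where
  J : Type v
  [instJ : SmallCategory J]
  filtered : IsCardinalFiltered J κ
  F : J ⥤ M
  mem : ∀ j, F.obj j ∈ P
  c : Cocone F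
  isColimit : IsColimit c
  iso : c.pt ≅ X

/-- A presentation of `X` as a `κ`-directed colimit of objects belonging to `P`. -/
structure DirectedColimitPresentation {M : Type u} [Category.{v} M] (κ : Cardinal.{v})
    (P : Set M) (X : M) where
  J : Type v
  [instJ : Preorder J]
  directed : IsCardinalDirected J κ
  F : J ⥤ M
  mem : ∀ j, F.obj j ∈ P
  c : Cocone F
  isColimit : IsColimit c
  iso : c.pt ≅ X

/-- A class of arrows (viewed as a full subcategory of the arrow category) is closed under
`κ`-filtered colimits. -/
def ClosedUnderFilteredColimits {M : Type u} [Category.{v} M] (κ : Cardinal.{v})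
    (P : Set (Arrow M)) : Prop :=
  ∀ (J : Type v) [SmallCategory J], IsCardinalFiltered J κ →
    ∀ (F : J ⥤ Arrow M) (c : Cocone F), IsColimit c → (∀ j, F.obj j ∈ P) → c.pt ∈ P

/-- The morphisms having the right lifting property with respect to every member of the
family `f`. -/
def RlpOf {M : Type u} [Category.{v} M] {ι : Type w} {A B : ι → M}
    (f : ∀ i, A i ⟶ B i) : MorphismProperty M :=
  fun _ _ g => ∀ i, HasLiftingProperty (f i) g

/-- The morphisms having the left lifting property with respect to every morphism in `P`. -/
def Llp {M : Type u} [Category.{v} M] (P : MorphismProperty M) : MorphismProperty M :=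
  fun _ _ g => ∀ ⦃X Y : M⦄ (p : X ⟶ Y), P p → HasLiftingProperty g p

/-- The class `C` is cofibrantly generated by a set of morphisms between `κ`-presentable
objects: `C = llp(rlp(I))` for such a set `I`. -/
def CofibrantlyGeneratedByPresentables {M : Type u} [Category.{v} M] (κ : Cardinal.{v})
    (C : MorphismProperty M) : Prop :=
  ∃ (ι : Type v) (A B : ι → M) (f : ∀ i, A i ⟶ B i),
    (∀ i, IsPresentable κ (A i)) ∧ (∀ i, IsPresentable κ (B i)) ∧
      C = Llp (RlpOf f)

/-- A category is locally `κ`-presentable: it is cocomplete and has a set of `κ`-presentable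
objects such that every object is a `κ`-filtered colimit of objects from this set. -/
def IsLocallyPresentable (M : Type u) [Category.{v} M] (κ : Cardinal.{v}) : Prop :=
  HasColimits M ∧
    ∃ (ι : Type v) (G : ι → M), (∀ i, IsPresentable κ (G i)) ∧
      ∀ X : M, Nonempty (FilteredColimitPresentation κ (Set.range G) X)

/-- A class of morphisms is stable under retracts (in the arrow category). -/
def IsStableUnderRetracts {M : Type u} [Category.{v} M] (P : MorphismProperty M) : Prop :=
  ∀ {X Y X' Y' : M} (f : X ⟶ Y) (g : X' ⟶ Y') (iX : X ⟶ X') (rX : X' ⟶ X)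
    (iY : Y ⟶ Y') (rY : Y' ⟶ Y), iX ≫ rX = 𝟙 X → iY ≫ rY = 𝟙 Y →
    iX ≫ g = f ≫ iY → rX ≫ f = g ≫ rY → P g → P f

/-- A model structure on a category: classes of weak equivalences, cofibrations and fibrations
satisfying the axioms of a (closed) model category. -/
structure ModelStructure (M : Type u) [Category.{v} M] where
  W : MorphismProperty M
  Cof : MorphismProperty M
  Fib : MorphismProperty M
  W_id : ∀ X : M, W (𝟙 X)
  W_comp : ∀ {X Y Z : M} (f : X ⟶ Y) (g : Y ⟶ Z), W f → W g → W (f ≫ g)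
  W_of_comp_right : ∀ {X Y Z : M} (f : X ⟶ Y) (g : Y ⟶ Z), W g → W (f ≫ g) → W f
  W_of_comp_left : ∀ {X Y Z : M} (f : X ⟶ Y) (g : Y ⟶ Z), W f → W (f ≫ g) → W g
  W_retract : IsStableUnderRetracts W
  Cof_retract : IsStableUnderRetracts Cof
  Fib_retract : IsStableUnderRetracts Fib
  lift_trivCof_fib : ∀ {A B X Y : M} (i : A ⟶ B) (p : X ⟶ Y),
    Cof i → W i → Fib p → HasLiftingProperty i p
  lift_cof_trivFib : ∀ {A B X Y : M} (i : A ⟶ B) (p : X ⟶ Y),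
    Cof i → Fib p → W p → HasLiftingProperty i p
  fact_cof_trivFib : ∀ {X Y : M} (f : X ⟶ Y),
    ∃ (Z : M) (i : X ⟶ Z) (p : Z ⟶ Y), Cof i ∧ Fib p ∧ W p ∧ i ≫ p = f
  fact_trivCof_fib : ∀ {X Y : M} (f : X ⟶ Y),
    ∃ (Z : M) (i : X ⟶ Z) (p : Z ⟶ Y), Cof i ∧ W i ∧ Fib p ∧ i ≫ p = f

/-- A model structure is `κ`-combinatorial if the underlying category is locally
`κ`-presentable and both cofibrations and trivial cofibrations are cofibrantly generated
by sets of morphisms between `κ`-presentable objects. -/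
structure IsCombinatorial {M : Type u} [Category.{v} M] (S : ModelStructure M)
    (κ : Cardinal.{v}) : Prop where
  isRegular : κ.IsRegular
  locallyPresentable : IsLocallyPresentable M κ
  cofGenerated : CofibrantlyGeneratedByPresentables κ S.Cof
  trivCofGenerated : CofibrantlyGeneratedByPresentables κ (S.Cof ⊓ S.W)

/-- An object is cofibrant if the morphism from an(y) initial object to it is a cofibration. -/
def Cofibrant {M : Type u} [Category.{v} M] (S : ModelStructure M) (X : M) : Prop :=
  ∀ ⦃O : M⦄, IsInitial O → ∀ f : O ⟶ X, S.Cof f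

/-- A cylinder object for `X`: a factorization `X ⊔ X → C → X` of the codiagonal into
a cofibration followed by a weak equivalence. -/
structure CylinderObject {M : Type u} [Category.{v} M] (S : ModelStructure M) (X : M) where
  C : M
  i₀ : X ⟶ C
  i₁ : X ⟶ C
  p : C ⟶ X
  hi₀ : i₀ ≫ p = 𝟙 X
  hi₁ : i₁ ≫ p = 𝟙 X
  hp : S.W p
  hcof : ∀ (c : BinaryCofan X X) (hc : IsColimit c), S.Cof (hc.desc (BinaryCofan.mk i₀ i₁))

/-- A commutative square on `(f, g, h, k)` (with `f : A ⟶ B`, `g : A ⟶ X`, `h : B ⟶ Y`,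
`k : X ⟶ Y`) is a homotopy pushout: for some (equivalently, any) replacement of the span
`B ← A → X` by a span of cofibrations between cofibrant objects which is weakly equivalent
to it, the comparison morphism from the (strict) pushout of the replacement to `Y` is a
weak equivalence. -/
def IsHomotopyPushout {M : Type u} [Category.{v} M] (S : ModelStructure M)
    {A B X Y : M} (f : A ⟶ B) (g : A ⟶ X) (h : B ⟶ Y) (k : X ⟶ Y) : Prop :=
  ∃ (A' B' X' P : M) (wA : A' ⟶ A) (i : A' ⟶ B') (wB : B' ⟶ B)
    (j : A' ⟶ X') (wX : X' ⟶ X) (pB : B' ⟶ P) (pX : X' ⟶ P) (m : P ⟶ Y),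
      Cofibrant S A' ∧ S.W wA ∧ S.Cof i ∧ S.W wB ∧ S.Cof j ∧ S.W wX ∧
      i ≫ wB = wA ≫ f ∧ j ≫ wX = wA ≫ g ∧
      IsPushout i j pB pX ∧ pB ≫ m = wB ≫ h ∧ pX ≫ m = wX ≫ k ∧ S.W m

/-- A morphism `i : A ⟶ B` is a formal cofibration if every pushout square of `i` along a
morphism `f : A ⟶ X` with `X` cofibrant is a homotopy pushout. -/
def IsFormalCofibration {M : Type u} [Category.{v} M] (S : ModelStructure M)
    {A B : M} (i : A ⟶ B) : Prop :=
  ∀ {X Y : M} (f : A ⟶ X) (g : B ⟶ Y) (k : X ⟶ Y),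
    Cofibrant S X → IsPushout i f g k → IsHomotopyPushout S i f g k

/-- The set of arrows satisfying `P` whose domain and codomain are `κ`-presentable. -/
def PresentableArrowsIn {M : Type u} [Category.{v} M] (κ : Cardinal.{v})
    (P : Set (Arrow M)) : Set (Arrow M) :=
  {a | a ∈ P ∧ IsPresentable κ a.left ∧ IsPresentable κ a.right}

end PaperAcc

namespace PaperAcc

open Opposite

section ArrowCategory

variable {M : Type u} [Category.{v} M]

/-- The morphism from the identity of `X` in the arrow category determined by a morphism from `X`
to the source. -/
def homOfId {X : M} {a : Arrow M} (x : X ⟶ a.left) : Arrow.mk (𝟙 X) ⟶ a :=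
  Arrow.homMk x (x ≫ a.hom) (Category.id_comp _).symm

/-- The morphism from the arrow `⊥_ M ⟶ X` in the arrow category determined by a morphism from
`X` to the target. -/
noncomputable def homOfInitialTo [HasInitial M] {X : M} {a : Arrow M} (x : X ⟶ a.right) :
    Arrow.mk (initial.to X) ⟶ a :=
  Arrow.homMk (initial.to a.left) x (initialIsInitial.hom_ext _ _)

lemma hom_ext_of_id {X : M} {a : Arrow M} {f g : Arrow.mk (𝟙 X) ⟶ a} (h : f.left = g.left) :
    f = g := by
  refine Arrow.hom_ext _ _ h ?_
  have hf := Arrow.w f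
  have hg := Arrow.w g
  dsimp at hf hg
  rw [Category.id_comp] at hf hg
  rw [← hf, ← hg, h]

lemma hom_ext_of_initialTo [HasInitial M] {X : M} {a : Arrow M}
    {f g : Arrow.mk (initial.to X) ⟶ a} (h : f.right = g.right) : f = g :=
  Arrow.hom_ext _ _ (initialIsInitial.hom_ext _ _) h

/-- Morphisms out of the identity of `X` in the arrow category are morphisms from `X` to the
source. -/
def coyonedaIdIso (X : M) :
    Arrow.leftFunc ⋙ coyoneda.obj (op X) ≅ coyoneda.obj (op (Arrow.mk (𝟙 X))) :=
  NatIso.ofComponents (fun _ => Equiv.toIso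
    { toFun := homOfId
      invFun := fun x => Arrow.Hom.left x
      left_inv := fun _ => rfl
      right_inv := fun _ => hom_ext_of_id rfl })
      (fun _ => by ext; exact hom_ext_of_id rfl)

/-- Morphisms out of the arrow `⊥_ M ⟶ X` in the arrow category are morphisms from `X` to the
target. -/
noncomputable def coyonedaInitialToIso [HasInitial M] (X : M) :
    Arrow.rightFunc ⋙ coyoneda.obj (op X) ≅ coyoneda.obj (op (Arrow.mk (initial.to X))) :=
  NatIso.ofComponents (fun _ => Equiv.toIso
    { toFun := homOfInitialTo
      invFun := fun x => Arrow.Hom.right x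
      left_inv := fun _ => rfl
      right_inv := fun _ => hom_ext_of_initialTo rfl })
      (fun _ => by ext; exact hom_ext_of_initialTo rfl)

/-- The arrows `𝟙 (G i)` and `⊥_ M ⟶ G i` associated to a family `G` of objects. -/
noncomputable def arrowFamily [HasInitial M] {ι : Type v} (G : ι → M) : ι ⊕ ι → Arrow M :=
  Sum.elim (fun i => Arrow.mk (𝟙 (G i))) (fun i => Arrow.mk (initial.to (G i)))

lemma arrowFamily_isStrongGenerator [HasInitial M] {ι : Type v} {G : ι → M}
    (hG : (ObjectProperty.ofObj G).IsStrongGenerator) :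
    (ObjectProperty.ofObj (arrowFamily G)).IsStrongGenerator := by
  rw [ObjectProperty.isStrongGenerator_iff]
  refine ⟨fun a b f g h => ?_, fun a b i _ h => ?_⟩
  · refine Arrow.hom_ext _ _ ?_ ?_
    · refine hG.isSeparating _ _ ?_
      rintro _ ⟨k⟩ x
      exact congrArg Arrow.Hom.left
        (h _ (ObjectProperty.ofObj_apply _ (Sum.inl k)) (homOfId x))
    · refine hG.isSeparating _ _ ?_
      rintro _ ⟨k⟩ x
      exact congrArg Arrow.Hom.right
        (h _ (ObjectProperty.ofObj_apply _ (Sum.inr k))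
          (homOfInitialTo x))
  · have hl : Mono i.left := ⟨fun x y hxy => congrArg Arrow.Hom.left
      ((cancel_mono i (g := homOfId x) (h := homOfId y)).1 (hom_ext_of_id hxy))⟩
    have hr : Mono i.right := ⟨fun x y hxy => congrArg Arrow.Hom.right
      ((cancel_mono i (g := homOfInitialTo x) (h := homOfInitialTo y)).1
        (hom_ext_of_initialTo hxy))⟩
    have : IsIso i.left := hG.isIso_of_mono _ (by
      rintro _ ⟨k⟩ x
      obtain ⟨y, hy⟩ := h _ (ObjectProperty.ofObj_apply _ (Sum.inl k))
        (homOfId x)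
      exact ⟨y.left, congrArg Arrow.Hom.left hy⟩)
    have : IsIso i.right := hG.isIso_of_mono _ (by
      rintro _ ⟨k⟩ x
      obtain ⟨y, hy⟩ := h _ (ObjectProperty.ofObj_apply _ (Sum.inr k))
        (homOfInitialTo x)
      exact ⟨y.right, congrArg Arrow.Hom.right hy⟩)
    exact Arrow.isIso_of_isIso_left_of_isIso_right i

variable [HasColimits M] {lam : Cardinal.{v}} [Fact lam.IsRegular]

lemma arrowFamily_le_isCardinalPresentable {ι : Type v} {G : ι → M}
    (hG : ∀ i, IsCardinalPresentable (G i) lam) :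
    ObjectProperty.ofObj (arrowFamily G) ≤ isCardinalPresentable (Arrow M) lam := by
  have : (Arrow.leftFunc (C := M)).IsCardinalAccessible lam := { }
  have : (Arrow.rightFunc (C := M)).IsCardinalAccessible lam := { }
  rintro _ ⟨i | i⟩
  · exact Functor.isCardinalAccessible_of_natIso (coyonedaIdIso (G i)) lam
  · exact Functor.isCardinalAccessible_of_natIso (coyonedaInitialToIso (G i)) lam

lemma arrow_isCardinalLocallyPresentable {ι : Type v} {G : ι → M}
    (hG : (ObjectProperty.ofObj G).IsStrongGenerator)
    (hG' : ∀ i, IsCardinalPresentable (G i) lam) :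
    IsCardinalLocallyPresentable (Arrow M) lam :=
  (IsCardinalLocallyPresentable.iff_exists_isStrongGenerator _ _).2
    ⟨_, inferInstance, arrowFamily_isStrongGenerator hG, arrowFamily_le_isCardinalPresentable hG'⟩

lemma isCardinalPresentable_left_right {ι : Type v} {G : ι → M}
    (hG : (ObjectProperty.ofObj G).IsStrongGenerator)
    (hG' : ∀ i, IsCardinalPresentable (G i) lam) :
    isCardinalPresentable (Arrow M) lam ≤
      (isCardinalPresentable M lam).inverseImage Arrow.leftFunc ⊓
        (isCardinalPresentable M lam).inverseImage Arrow.rightFunc := by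
  rw [IsStrongGenerator.colimitsCardinalClosure_eq_isCardinalPresentable
    (arrowFamily_isStrongGenerator hG) (arrowFamily_le_isCardinalPresentable hG')]
  have hclosed (J : Type v) [SmallCategory J] (hJ : HasCardinalLT (Arrow J) lam) :
      (isCardinalPresentable M lam).IsClosedUnderColimitsOfShape J :=
    isClosedUnderColimitsOfShape_isCardinalPresentable.{v} M hJ
  refine ObjectProperty.colimitsCardinalClosure_le _ _ (fun J _ hJ => ⟨?_⟩) ?_
  · rintro a ⟨p⟩
    have := hclosed J hJ
    exact ⟨ObjectProperty.prop_of_isColimit _ (isColimitOfPreserves Arrow.leftFunc p.isColimit)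
        fun j => (p.prop_diag_obj j).1,
      ObjectProperty.prop_of_isColimit _ (isColimitOfPreserves Arrow.rightFunc p.isColimit)
        fun j => (p.prop_diag_obj j).2⟩
  · have h0 : isCardinalPresentable M lam (⊥_ M) := by
      have := isClosedUnderColimitsOfShape_isCardinalPresentable.{v} M (κ := lam)
        (J := Discrete PEmpty.{1})
        (hasCardinalLT_of_finite _ _ (Cardinal.IsRegular.aleph0_le Fact.out))
      exact ObjectProperty.prop_of_isColimit _ (colimit.isColimit _) fun j => j.as.elim
    rintro _ ⟨i | i⟩
    · exact ⟨hG' i, hG' i⟩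
    · exact ⟨h0, hG' i⟩

end ArrowCategory

section Bridge

variable {κ : Cardinal.{v}} [Fact κ.IsRegular]

lemma isCardinalFiltered_iff {J : Type v} [SmallCategory J] :
    IsCardinalFiltered J κ ↔ CategoryTheory.IsCardinalFiltered J κ :=
  ⟨fun h => ⟨fun F hA => h _ ((hasCardinalLT_iff_cardinal_mk_lt _ _).1 hA) F⟩,
    fun _ _ _ hA F =>
      ⟨IsCardinalFiltered.cocone F ((hasCardinalLT_iff_cardinal_mk_lt _ κ).2 hA)⟩⟩

lemma isPresentable_iff {M : Type u} [Category.{v} M] {X : M} :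
    IsPresentable κ X ↔ IsCardinalPresentable X κ :=
  ⟨fun h => ⟨fun J _ _ => (h J (isCardinalFiltered_iff.2 inferInstance)).some⟩,
    fun _ J _ hJ => by
      have := isCardinalFiltered_iff.1 hJ
      exact ⟨preservesColimitsOfShape_of_isCardinalPresentable X κ J⟩⟩

lemma IsLocallyPresentable.exists_isStrongGenerator {M : Type u} [Category.{v} M]
    (h : IsLocallyPresentable M κ) :
    ∃ (ι : Type v) (G : ι → M), (∀ i, IsCardinalPresentable (G i) κ) ∧
      (ObjectProperty.ofObj G).IsStrongGenerator := by
  obtain ⟨_, ι, G, hG, hG'⟩ := h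
  have hgen : (ObjectProperty.ofObj G).IsCardinalFilteredGenerator κ :=
    { le_isCardinalPresentable := by
        rintro _ ⟨i⟩
        exact isPresentable_iff.1 (hG i)
      exists_colimitsOfShape := fun X => by
        obtain ⟨J, hJ, F, hF, c, hc, e⟩ := hG' X
        refine ⟨J, inferInstance, isCardinalFiltered_iff.1 hJ, ⟨ObjectProperty.ColimitOfShape.mk
          (ColimitPresentation.mk F (c.ι ≫ (Functor.const J).map e.hom)
            (IsColimit.ofIsoColimit hc (Cocone.ext e (fun _ => rfl)))) fun j => ?_⟩⟩
        obtain ⟨i, hi⟩ := hF j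
        exact hi ▸ ObjectProperty.ofObj_apply _ i }
  exact ⟨ι, G, fun i => isPresentable_iff.1 (hG i), hgen.isStrongGenerator⟩

end Bridge

namespace ModelStructure

variable {M : Type u} [Category.{v} M] (S : ModelStructure M)

lemma W_of_isIso {X Y : M} (f : X ⟶ Y) [IsIso f] : S.W f :=
  S.W_retract f (𝟙 Y) f (inv f) (𝟙 Y) (𝟙 Y) (by simp) (by simp) (by simp) (by simp) (S.W_id Y)

lemma W_of_rlpOf {ι : Type v} {A B : ι → M} {i : ∀ k, A k ⟶ B k}
    (hi : S.Cof = Llp (RlpOf i)) {X Y : M} {g : X ⟶ Y} (hg : RlpOf i g) : S.W g := by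
  obtain ⟨Z, j, p, hj, -, hp, fac⟩ := S.fact_cof_trivFib g
  have hj' : Llp (RlpOf i) j := hi ▸ hj
  have := hj' g hg
  have sq : CommSq (𝟙 X) j g p := ⟨by simpa using fac.symm⟩
  exact S.W_retract g p j sq.lift (𝟙 Y) (𝟙 Y) (by simp) (by simp) (by simpa using fac)
    (by simp) hp

lemma rlpOf_of_fib_of_W {ι : Type v} {A B : ι → M} {i : ∀ k, A k ⟶ B k}
    (hi : S.Cof = Llp (RlpOf i)) {X Y : M} {g : X ⟶ Y} (hg : S.Fib g) (hg' : S.W g) :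
    RlpOf i g := fun k =>
  S.lift_cof_trivFib _ _ (by rw [hi]; exact fun _ _ _ hp => hp k) hg hg'

/-- A morphism in the arrow category whose components are weak equivalences identifies weak
equivalences. -/
lemma W_hom_iff {a b : Arrow M} (φ : a ⟶ b) (hl : S.W φ.left) (hr : S.W φ.right) :
    S.W a.hom ↔ S.W b.hom := by
  have hw : φ.left ≫ b.hom = a.hom ≫ φ.right := Arrow.w φ
  refine ⟨fun h => S.W_of_comp_left _ _ hl ?_, fun h => S.W_of_comp_right _ _ hr ?_⟩
  · rw [hw]
    exact S.W_comp _ _ h hr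
  · rw [← hw]
    exact S.W_comp _ _ hl h

end ModelStructure

section Colimits

variable {M : Type u} [Category.{v} M] [HasColimits M] {κ : Cardinal.{v}} [Fact κ.IsRegular]

/-- A filtered colimit of arrows has the right lifting property against morphisms between
presentable objects, as soon as each arrow admits a transition morphism that factors through an
arrow with this property. -/
lemma rlpOf_of_isColimit {ι : Type v} {A B : ι → M} (i : ∀ k, A k ⟶ B k)
    [∀ k, IsCardinalPresentable (A k) κ] [∀ k, IsCardinalPresentable (B k) κ]
    {J : Type v} [SmallCategory J] [CategoryTheory.IsCardinalFiltered J κ]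
    {D : J ⥤ Arrow M} {c : Cocone D} (hc : IsColimit c)
    (h : ∀ j, ∃ (j' : J) (u : j ⟶ j') (t : Arrow M) (p : D.obj j ⟶ t) (q : t ⟶ D.obj j'),
      RlpOf i t.hom ∧ p ≫ q = D.map u) :
    RlpOf i c.pt.hom := by
  refine fun k => ⟨fun {x y} sq => ?_⟩
  have hl := isColimitOfPreserves Arrow.leftFunc hc
  have hr := isColimitOfPreserves Arrow.rightFunc hc
  obtain ⟨j₁, x₁, hx₁⟩ : ∃ (j₁ : J) (x₁ : A k ⟶ (D.obj j₁).left), x₁ ≫ (c.ι.app j₁).left = x :=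
    IsCardinalPresentable.exists_hom_of_isColimit κ hl x
  obtain ⟨j₂, y₁, hy₁⟩ : ∃ (j₂ : J) (y₁ : B k ⟶ (D.obj j₂).right),
      y₁ ≫ (c.ι.app j₂).right = y := IsCardinalPresentable.exists_hom_of_isColimit κ hr y
  obtain ⟨j, u, v, huv⟩ : ∃ (j : J) (u : j₁ ⟶ j) (v : j₂ ⟶ j),
      (x₁ ≫ (D.obj j₁).hom) ≫ (D.map u).right = (i k ≫ y₁) ≫ (D.map v).right := by
    refine IsCardinalPresentable.exists_eq_of_isColimit κ hr
      (x₁ ≫ (D.obj j₁).hom) (i k ≫ y₁) ?_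
    have := Arrow.w (c.ι.app j₁)
    change (x₁ ≫ (D.obj j₁).hom) ≫ (c.ι.app j₁).right = (i k ≫ y₁) ≫ (c.ι.app j₂).right
    dsimp at this ⊢
    rw [Category.assoc, Category.assoc, hy₁, ← sq.w, ← hx₁, Category.assoc, ← this]
  obtain ⟨j', w, t, p, q, ht, fac⟩ := h j
  have hu := Arrow.w (D.map u)
  have hp := Arrow.w p
  have hq := Arrow.w q
  have hj' := Arrow.w (c.ι.app j')
  dsimp at hj'
  have sq' : CommSq (x₁ ≫ (D.map u).left ≫ p.left) (i k) t.hom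
      (y₁ ≫ (D.map v).right ≫ p.right) := ⟨by
    simp only [Category.assoc] at huv ⊢
    rw [hp, reassoc_of% hu, reassoc_of% huv]⟩
  have := ht k
  have hleft : p.left ≫ q.left ≫ (c.ι.app j').left = (c.ι.app j).left := by
    rw [← c.w w, ← fac]
    simp
  have hright : p.right ≫ q.right ≫ (c.ι.app j').right = (c.ι.app j).right := by
    rw [← c.w w, ← fac]
    simp
  refine ⟨⟨⟨sq'.lift ≫ q.left ≫ (c.ι.app j').left, ?_, ?_⟩⟩⟩
  · rw [sq'.fac_left_assoc, Category.assoc, Category.assoc, hleft, ← hx₁, ← c.w u, Arrow.comp_left]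
  · rw [Category.assoc, Category.assoc, hj', reassoc_of% hq, sq'.fac_right_assoc,
      Category.assoc, Category.assoc, hright, ← hy₁, ← c.w v, Arrow.comp_right]

end Colimits

section WeakEquivalences

variable {M : Type u} [Category.{v} M]

/-- A filtered colimit of arrows is a weak equivalence as soon as, after fibrant replacement, each
arrow admits a transition morphism that factors through a trivial fibration. -/
lemma W_of_isColimit [HasColimits M] {κ : Cardinal.{v}} [Fact κ.IsRegular] (S : ModelStructure M)
    (hcof : CofibrantlyGeneratedByPresentables κ S.Cof) {R : Arrow M ⥤ Arrow M}
    (η : 𝟭 (Arrow M) ⟶ R) (hη : ∀ a, S.W (η.app a).left ∧ IsIso (η.app a).right)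
    {J : Type v} [SmallCategory J] [CategoryTheory.IsCardinalFiltered J κ]
    [PreservesColimitsOfShape J R] {D : J ⥤ Arrow M} {c : Cocone D} (hc : IsColimit c)
    (h : ∀ j, ∃ (j' : J) (u : j ⟶ j') (t : Arrow M) (p : R.obj (D.obj j) ⟶ t)
      (q : t ⟶ R.obj (D.obj j')), S.Fib t.hom ∧ S.W t.hom ∧ p ≫ q = R.map (D.map u)) :
    S.W c.pt.hom := by
  obtain ⟨ι, A, B, i, hA, hB, hi⟩ := hcof
  have (k : ι) := isPresentable_iff.1 (hA k)
  have (k : ι) := isPresentable_iff.1 (hB k)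
  have := (hη c.pt).2
  refine (S.W_hom_iff (η.app c.pt) (hη c.pt).1 (S.W_of_isIso _)).2 (S.W_of_rlpOf hi
    (rlpOf_of_isColimit (κ := κ) i (isColimitOfPreserves R hc) fun j => ?_))
  obtain ⟨j', u, t, p, q, ht, ht', fac⟩ := h j
  exact ⟨j', u, t, p, q, S.rlpOf_of_fib_of_W hi ht ht', fac⟩

lemma exists_comp_eq_of_hasLiftingProperty {a b t : Arrow M} (e : a ⟶ t) [IsIso e.right]
    [HasLiftingProperty e.left b.hom] (φ : a ⟶ b) : ∃ l : t ⟶ b, e ≫ l = φ := by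
  have he : e.left ≫ t.hom = a.hom ≫ e.right := Arrow.w e
  have hφ : φ.left ≫ b.hom = a.hom ≫ φ.right := Arrow.w φ
  have sq : CommSq φ.left e.left b.hom (t.hom ≫ inv e.right ≫ φ.right) :=
    ⟨by rw [reassoc_of% he, IsIso.hom_inv_id_assoc, hφ]⟩
  refine ⟨Arrow.homMk sq.lift (inv e.right ≫ φ.right) sq.fac_right, Arrow.hom_ext _ _ ?_ ?_⟩
  · exact sq.fac_left
  · exact IsIso.hom_inv_id_assoc _ _

/-- If a `lam`-filtered colimit of `lam`-presentable arrows is a weak equivalence, then, after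
fibrant replacement, each of these arrows admits a transition morphism which factors through its
replacement by a trivial fibration. -/
lemma exists_comp_eq_map_of_W {lam : Cardinal.{v}} [Fact lam.IsRegular] (S : ModelStructure M)
    {R Q : Arrow M ⥤ Arrow M} (η : 𝟭 (Arrow M) ⟶ R) (θ : 𝟭 (Arrow M) ⟶ Q)
    (hη : ∀ a, S.W (η.app a).left ∧ IsIso (η.app a).right) (hR : ∀ a, S.Fib (R.obj a).hom)
    (hθ : ∀ a, S.Cof (θ.app a).left ∧ IsIso (θ.app a).right)
    (hR' : ∀ a, IsCardinalPresentable a lam → IsCardinalPresentable (R.obj a) lam)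
    (hQ : ∀ a, IsCardinalPresentable a lam → IsCardinalPresentable (Q.obj a) lam)
    {J : Type v} [SmallCategory J] [CategoryTheory.IsCardinalFiltered J lam]
    [PreservesColimitsOfShape J R] {D : J ⥤ Arrow M} {c : Cocone D} (hc : IsColimit c)
    (hW : S.W c.pt.hom) (j : J) [IsCardinalPresentable (D.obj j) lam] :
    ∃ (j' : J) (u : j ⟶ j') (q : Q.obj (R.obj (D.obj j)) ⟶ R.obj (D.obj j')),
      θ.app (R.obj (D.obj j)) ≫ q = R.map (D.map u) := by
  have := (hη c.pt).2
  have := (hθ (R.obj (D.obj j))).2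
  have hW' := (S.W_hom_iff (η.app c.pt) (hη c.pt).1 (S.W_of_isIso _)).1 hW
  have := S.lift_cof_trivFib _ _ (hθ (R.obj (D.obj j))).1 (hR c.pt) hW'
  have h₁ := hR' (D.obj j) inferInstance
  have h₂ := hQ _ h₁
  have hc' := isColimitOfPreserves R hc
  obtain ⟨l, hl⟩ := exists_comp_eq_of_hasLiftingProperty (θ.app (R.obj (D.obj j)))
    (b := R.obj c.pt) (R.map (c.ι.app j))
  obtain ⟨j₁, q, hq⟩ := IsCardinalPresentable.exists_hom_of_isColimit lam hc' l
  obtain ⟨j', u, w, huw⟩ := IsCardinalPresentable.exists_eq_of_isColimit lam hc'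
    (i₁ := j) (i₂ := j₁) (𝟙 (R.obj (D.obj j))) (θ.app (R.obj (D.obj j)) ≫ q) (by
      refine (Category.id_comp _).trans (hl.symm.trans ?_)
      rw [← hq]
      exact (Category.assoc _ _ _).symm)
  exact ⟨j', u, q ≫ R.map (D.map w), ((Category.assoc _ _ _).symm.trans huw.symm).trans
    (Category.id_comp _)⟩

end WeakEquivalences

section Chains

/-- In a `lam`-directed poset, any element `x₀` and any map `s` with `x ≤ s x` have a chain of
regular length `κ < lam` above `x₀` along which `s` is eventually dominated. -/
lemma exists_functor_of_le {κ lam : Cardinal.{v}} [Fact lam.IsRegular]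
    (h : κ < lam) {α : Type v} [PartialOrder α] [CategoryTheory.IsCardinalFiltered α lam]
    (x₀ : α) (s : α → α) (hs : ∀ x, x ≤ s x) :
    ∃ H : κ.ord.ToType ⥤ α, (∀ i, x₀ ≤ H.obj i) ∧ ∀ i j, i < j → s (H.obj i) ≤ H.obj j := by
  have hcard (i : κ.ord.ToType) : HasCardinalLT (Option (Set.Iio i)) lam := by
    rw [hasCardinalLT_option_iff _ _ (Cardinal.IsRegular.aleph0_le Fact.out),
      hasCardinalLT_iff_cardinal_mk_lt]
    exact (Cardinal.mk_set_le _).trans_lt (by simpa using h)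
  let step (i : κ.ord.ToType) (f : ∀ j, j < i → α) : α :=
    IsCardinalFiltered.max (fun o : Option (Set.Iio i) => o.elim x₀ fun j => s (f j.1 j.2))
      (hcard i)
  let H : κ.ord.ToType → α := wellFounded_lt.fix step
  have hH (i) : H i = step i fun j _ => H j := wellFounded_lt.fix_eq step i
  have h₀ (i) : x₀ ≤ H i := by
    rw [hH]
    exact leOfHom (IsCardinalFiltered.toMax
      (fun o : Option (Set.Iio i) => o.elim x₀ fun k => s (H k.1)) (hcard i) none)
  have h₁ (i j) (hij : i < j) : s (H i) ≤ H j := by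
    rw [hH j]
    exact leOfHom (IsCardinalFiltered.toMax
      (fun o : Option (Set.Iio j) => o.elim x₀ fun k => s (H k.1)) (hcard j) (some ⟨i, hij⟩))
  have hmono : Monotone H := fun i j hij => hij.lt_or_eq.elim
    (fun hij => (hs _).trans (h₁ i j hij)) fun hij => hij ▸ le_rfl
  exact ⟨hmono.functor, h₀, h₁⟩

lemma hasCardinalLT_arrow_toType {κ lam : Cardinal.{v}} [Fact lam.IsRegular] (h : κ < lam) :
    HasCardinalLT (Arrow κ.ord.ToType) lam := by
  have hκ : HasCardinalLT κ.ord.ToType lam := by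
    simpa [hasCardinalLT_iff_cardinal_mk_lt] using h
  refine (hasCardinalLT_prod (Cardinal.IsRegular.aleph0_le Fact.out) hκ hκ).of_injective
    (fun f => (f.left, f.right)) ?_
  rintro ⟨_, _, _⟩ ⟨_, _, _⟩ hfg
  obtain ⟨rfl, rfl⟩ := Prod.mk.inj hfg
  exact congrArg (Arrow.mk (X := _) (Y := _)) (Subsingleton.elim _ _)

end Chains

/-- In a `lam`-accessible category, an object is a `lam`-filtered colimit of `lam`-presentable
objects satisfying a property `W` when any morphism to it from a `lam`-presentable object factors
through such an object. -/
lemma exists_colimitsOfShape_of_exists_comp_eq {C : Type u} [Category.{v} C]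
    {lam : Cardinal.{v}} [Fact lam.IsRegular] [IsCardinalAccessibleCategory C lam]
    (W : ObjectProperty C) [W.IsClosedUnderIsomorphisms] (f : C)
    (hf : ∀ (a : C) [IsCardinalPresentable a lam] (g : a ⟶ f),
      ∃ (b : C) (_ : IsCardinalPresentable b lam) (_ : W b) (g₁ : a ⟶ b) (g₂ : b ⟶ f),
        g₁ ≫ g₂ = g) :
    ∃ (J : Type v) (_ : SmallCategory J) (_ : CategoryTheory.IsCardinalFiltered J lam),
      (W ⊓ isCardinalPresentable C lam).colimitsOfShape J f := by
  let P := isCardinalPresentable C lam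
  let e := equivSmallModel.{v} (CostructuredArrow P.ι f)
  let D := e.inverse ⋙ CostructuredArrow.proj P.ι f ⋙ P.ι
  have : CategoryTheory.IsCardinalFiltered (SmallModel.{v} (CostructuredArrow P.ι f)) lam :=
    .of_equivalence lam e
  let K : ObjectProperty (SmallModel.{v} (CostructuredArrow P.ι f)) := W.inverseImage D
  have hK (x) : ∃ y : K.FullSubcategory, Nonempty (x ⟶ K.ι.obj y) := by
    have : IsCardinalPresentable (D.obj x) lam := (e.inverse.obj x).left.2
    obtain ⟨b, hb, hb', g₁, g₂, hg⟩ := hf (D.obj x) (e.inverse.obj x).hom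
    let b' : CostructuredArrow P.ι f :=
      CostructuredArrow.mk (S := P.ι) (Y := (⟨b, hb⟩ : P.FullSubcategory)) g₂
    exact ⟨⟨e.functor.obj b', W.prop_of_iso
      ((CostructuredArrow.proj P.ι f ⋙ P.ι).mapIso (e.unitIso.app b')) hb'⟩,
      ⟨e.counitInv.app x ≫ e.functor.map
        (CostructuredArrow.homMk (ObjectProperty.homMk g₁) hg)⟩⟩
  have := isFiltered_of_isCardinalFiltered (SmallModel.{v} (CostructuredArrow P.ι f)) lam
  have := Functor.final_of_exists_of_isFiltered_of_fullyFaithful K.ι hK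
  refine ⟨K.FullSubcategory, inferInstance, ⟨fun {A} _ F hA => ?_⟩, ⟨?_⟩⟩
  · let c := IsCardinalFiltered.cocone (F ⋙ K.ι) hA
    obtain ⟨y, ⟨φ⟩⟩ := hK c.pt
    exact ⟨{
      pt := y
      ι :=
        { app := fun k => K.homMk (c.ι.app k ≫ φ)
          naturality := fun k l ψ => by
            apply K.ι.map_injective
            have := c.w_assoc ψ φ
            simpa using this } }⟩
  · have hc := (Functor.Final.isColimitWhiskerEquiv K.ι _).symm
      ((P.ι.denseAt f).whiskerEquivalence e.symm)
    exact
      { diag := K.ι ⋙ D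
        ι := (Cocone.whisker K.ι (Cocone.whisker e.symm.functor
          ((Functor.LeftExtension.mk (𝟭 _) P.ι.rightUnitor.inv).coconeAt f))).ι
        isColimit := hc
        prop_diag_obj := fun y => ⟨y.2, (e.inverse.obj y.1).left.2⟩ }

section Accessibility

variable {M : Type u} [Category.{v} M] [HasColimits M] {κ lam : Cardinal.{v}}
  [Fact κ.IsRegular] [Fact lam.IsRegular] [IsCardinalLocallyPresentable (Arrow M) lam]

/-- Any morphism from a `lam`-presentable arrow to a weak equivalence factors through a
`lam`-presentable weak equivalence. -/
lemma exists_isCardinalPresentable_W_comp_eq (h : κ < lam) (S : ModelStructure M)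
    (hcof : CofibrantlyGeneratedByPresentables κ S.Cof)
    {R Q : Arrow M ⥤ Arrow M} [R.IsCardinalAccessible κ] (η : 𝟭 (Arrow M) ⟶ R)
    (θ : 𝟭 (Arrow M) ⟶ Q)
    (hη : ∀ a, S.W (η.app a).left ∧ IsIso (η.app a).right) (hR : ∀ a, S.Fib (R.obj a).hom)
    (hθ : ∀ a, S.Cof (θ.app a).left ∧ IsIso (θ.app a).right)
    (hQ : ∀ a, S.Fib (Q.obj a).hom ∧ S.W (Q.obj a).hom)
    (hR' : ∀ a, IsCardinalPresentable a lam → IsCardinalPresentable (R.obj a) lam)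
    (hQ' : ∀ a, IsCardinalPresentable a lam → IsCardinalPresentable (Q.obj a) lam)
    {a f : Arrow M} [IsCardinalPresentable a lam] (g : a ⟶ f) (hf : S.W f.hom) :
    ∃ (b : Arrow M) (_ : IsCardinalPresentable b lam) (_ : S.W b.hom) (g₁ : a ⟶ b) (g₂ : b ⟶ f),
      g₁ ≫ g₂ = g := by
  obtain ⟨J, _, _, ⟨p⟩⟩ :=
    (isCardinalFilteredGenerator_isCardinalPresentable (Arrow M) lam).exists_colimitsOfShape f
  obtain ⟨α, _, _, F, _⟩ := IsCardinalFiltered.exists_cardinal_directed J lam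
  have hα : CategoryTheory.IsCardinalFiltered α κ := .of_le α h.le
  let D := F ⋙ p.diag
  let c : Cocone D := p.cocone.whisker F
  have hc : IsColimit c := (Functor.Final.isColimitWhiskerEquiv F _).symm p.isColimit
  have hD (x : α) : IsCardinalPresentable (D.obj x) lam := p.prop_diag_obj _
  have := R.preservesColimitsOfShape_of_isCardinalAccessible κ α
  obtain ⟨x₀, g₀, hg₀⟩ := IsCardinalPresentable.exists_hom_of_isColimit lam hc g
  choose s u q hq using fun x => exists_comp_eq_map_of_W S η θ hη hR hθ hR' hQ' hc hf x
  obtain ⟨H, hH₀, hH₁⟩ := exists_functor_of_le (κ := κ) h x₀ s fun x => leOfHom (u x)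
  have : NoMaxOrder κ.ord.ToType := Cardinal.noMaxOrder (Cardinal.IsRegular.aleph0_le Fact.out)
  obtain ⟨i₀⟩ : Nonempty κ.ord.ToType := (isFiltered_of_isCardinalFiltered κ.ord.ToType κ).nonempty
  have := R.preservesColimitsOfShape_of_isCardinalAccessible κ κ.ord.ToType
  refine ⟨colimit (H ⋙ D), ?_, ?_, g₀ ≫ D.map (homOfLE (hH₀ i₀)) ≫ colimit.ι (H ⋙ D) i₀,
    colimit.desc (H ⋙ D) (c.whisker H), ?_⟩
  · have (i : κ.ord.ToType) : IsCardinalPresentable ((H ⋙ D).obj i) lam := hD (H.obj i)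
    exact isCardinalPresentable_of_isColimit _ (colimit.isColimit (H ⋙ D)) lam
      (hasCardinalLT_arrow_toType h)
  · refine W_of_isColimit S hcof η hη (colimit.isColimit (H ⋙ D)) fun i => ?_
    obtain ⟨j, hij⟩ := exists_gt i
    refine ⟨j, homOfLE hij.le, _, θ.app _, q (H.obj i) ≫ R.map (D.map (homOfLE (hH₁ i j hij))),
      (hQ _).1, (hQ _).2, ?_⟩
    refine ((reassoc_of% (hq (H.obj i))) _).trans ?_
    rw [← R.map_comp, ← D.map_comp]
    rfl
  · rw [Category.assoc, Category.assoc, colimit.ι_desc]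
    exact (congrArg _ (c.w _)).trans hg₀

end Accessibility

/-- Proposition 2.3. Let `M` be a `κ`-combinatorial model category, let
`Rfib : M^→ ⥤ M^→` be the replacement-by-fibration functor arising from the (trivial
cofibration, fibration)-factorization given by the small object argument (so there is a
natural morphism `f ⟶ Rfib f` whose first component is a trivial cofibration and whose
second component is invertible, `Rfib f` is a fibration, and `Rfib` preserves `κ`-filtered
colimits), and similarly let `Rwfib` be the replacement-by-trivial-fibration functor arising
from the (cofibration, trivial fibration)-factorization. Let `λ > κ` be a regular cardinal
such that both `Rfib` and `Rwfib` preserve `λ`-presentable objects. Then the full subcategory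
`W` of weak equivalences in `M^→` is `λ`-accessible and is closed under `κ`-filtered
colimits in `M^→`. -/
theorem statement6 {M : Type u} [Category.{v} M] (κ lam : Cardinal.{v})
    (S : ModelStructure M) (hcomb : IsCombinatorial S κ)
    (hlam : lam.IsRegular) (hκlam : κ < lam)
    (Rfib Rwfib : Arrow M ⥤ Arrow M)
    (ηf : 𝟭 (Arrow M) ⟶ Rfib) (ηw : 𝟭 (Arrow M) ⟶ Rwfib)
    (hRfib : ∀ a : Arrow M, S.Cof (ηf.app a).left ∧ S.W (ηf.app a).left ∧
      IsIso (ηf.app a).right ∧ S.Fib (Rfib.obj a).hom)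
    (hRwfib : ∀ a : Arrow M, S.Cof (ηw.app a).left ∧ IsIso (ηw.app a).right ∧
      S.Fib (Rwfib.obj a).hom ∧ S.W (Rwfib.obj a).hom)
    (hRfib_colim : ∀ (J : Type v) [SmallCategory J], IsCardinalFiltered J κ →
      Nonempty (PreservesColimitsOfShape J Rfib))
    (hRwfib_colim : ∀ (J : Type v) [SmallCategory J], IsCardinalFiltered J κ →
      Nonempty (PreservesColimitsOfShape J Rwfib))
    (hRfib_pres : ∀ a : Arrow M, IsPresentable lam a → IsPresentable lam (Rfib.obj a))
    (hRwfib_pres : ∀ a : Arrow M, IsPresentable lam a → IsPresentable lam (Rwfib.obj a)) :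
    (ClosedUnderFilteredColimits lam {a : Arrow M | S.W a.hom} ∧
      ∀ {X Y : M} (f : X ⟶ Y), S.W f →
        Nonempty (FilteredColimitPresentation (M := Arrow M) lam
          (PresentableArrowsIn lam {a : Arrow M | S.W a.hom}) (Arrow.mk f))) ∧
    ClosedUnderFilteredColimits κ {a : Arrow M | S.W a.hom} := by
  have : Fact κ.IsRegular := ⟨hcomb.isRegular⟩
  have : Fact lam.IsRegular := ⟨hlam⟩
  have : HasColimits M := hcomb.locallyPresentable.1
  have : Rfib.IsCardinalAccessible κ :=
    ⟨fun J _ _ => (hRfib_colim J (isCardinalFiltered_iff.2 inferInstance)).some⟩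
  obtain ⟨ι, G, hGκ, hG⟩ := hcomb.locallyPresentable.exists_isStrongGenerator
  have hGlam (i : ι) : IsCardinalPresentable (G i) lam := isCardinalPresentable_of_le _ hκlam.le
  have := arrow_isCardinalLocallyPresentable hG hGlam
  have hη (a : Arrow M) : S.W (ηf.app a).left ∧ IsIso (ηf.app a).right :=
    ⟨(hRfib a).2.1, (hRfib a).2.2.1⟩
  have hclosed : ClosedUnderFilteredColimits κ {a : Arrow M | S.W a.hom} := by
    intro J _ hJ D c hc hD
    have := isCardinalFiltered_iff.1 hJ
    have := Rfib.preservesColimitsOfShape_of_isCardinalAccessible κ J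
    refine W_of_isColimit S hcomb.cofGenerated ηf hη hc fun j =>
      ⟨j, 𝟙 j, Rfib.obj (D.obj j), 𝟙 _, 𝟙 _, (hRfib _).2.2.2, ?_, by simp⟩
    have := (hη (D.obj j)).2
    exact (S.W_hom_iff (ηf.app (D.obj j)) (hη _).1 (S.W_of_isIso _)).1 (hD j)
  refine ⟨⟨fun J _ hJ => ?_, fun f hf => ?_⟩, hclosed⟩
  · have := isCardinalFiltered_iff.1 hJ
    exact hclosed J (isCardinalFiltered_iff.2 (.of_le J hκlam.le))
  · let W : ObjectProperty (Arrow M) := fun a => S.W a.hom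
    have : W.IsClosedUnderIsomorphisms :=
      ⟨fun e => (S.W_hom_iff e.hom (S.W_of_isIso _) (S.W_of_isIso _)).1⟩
    obtain ⟨J, _, hJ, ⟨p⟩⟩ := exists_colimitsOfShape_of_exists_comp_eq (lam := lam) W (Arrow.mk f)
      fun a _ g => exists_isCardinalPresentable_W_comp_eq hκlam S hcomb.cofGenerated ηf ηw hη
        (fun a => (hRfib a).2.2.2) (fun a => ⟨(hRwfib a).1, (hRwfib a).2.1⟩)
        (fun a => (hRwfib a).2.2)
        (fun a ha => isPresentable_iff.1 (hRfib_pres a (isPresentable_iff.2 ha)))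
        (fun a ha => isPresentable_iff.1 (hRwfib_pres a (isPresentable_iff.2 ha))) g hf
    exact ⟨{
      J := J
      filtered := isCardinalFiltered_iff.2 hJ
      F := p.diag
      mem := fun j => by
        have hj := isCardinalPresentable_left_right hG hGlam _ (p.prop_diag_obj j).2
        exact ⟨(p.prop_diag_obj j).1, isPresentable_iff.2 hj.1, isPresentable_iff.2 hj.2⟩
      c := p.cocone
      isColimit := p.isColimit
      iso := Iso.refl _ }⟩

end PaperAcc
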